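/- Consider the consensus-voting group process on the unit square ℍ = [0,1]². Then there exists a constant c > 0 such that for every T ≥ 2, the expected group size after T rounds satisfies E[|G^T|] ≥ c·ln(T). -/

import Mathlib

open MeasureTheory Metric Set
open scoped RealInnerProductSpace ENNReal

noncomputable section

/-- Points of the plane (with the Euclidean norm). -/
abbrev Pt : Type := EuclideanSpace ℝ (Fin 2)

/-- The Voronoi cell of `w₁` (against competitor `w₂`) inside `K`. -/
def vcell (K : Set Pt) (w₁ w₂ : Pt) : Set Pt := {v ∈ K | dist v w₁ ≤ dist v w₂}

/-- The acceptance event `E_K(H, A)`: the set of candidate pairs `(w₁, w₂) ∈ K × K` such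
that some candidate `wᵢ` lies in `H` and `A` is contained in its Voronoi cell, i.e. a
candidate inside `H` is accepted when the convex hull of the group is `A`. -/
def accEvent (K H A : Set Pt) : Set (Pt × Pt) :=
  {p | p.1 ∈ K ∧ p.2 ∈ K ∧
    ((p.1 ∈ H ∧ A ⊆ vcell K p.1 p.2) ∨ (p.2 ∈ H ∧ A ⊆ vcell K p.2 p.1))}

/-- Every group member weakly prefers candidate `w₁` to candidate `w₂`. -/
def Accepts (G : Set Pt) (w₁ w₂ : Pt) : Prop := ∀ v ∈ G, dist v w₁ ≤ dist v w₂

open Classical in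
/-- One round of the consensus-voting process: given the current group `G` and a pair of
candidates `c = (w₁, w₂)`, the unanimously preferred candidate (if any) joins the group. -/
def step (G : Set Pt) (c : Pt × Pt) : Set Pt :=
  if Accepts G c.1 c.2 then insert c.1 G
  else if Accepts G c.2 c.1 then insert c.2 G
  else G

/-- The group after `t` rounds, from initial members `init` and candidate pairs `c`. -/
def grp {k : ℕ} (init : Fin k → Pt) (c : ℕ → Pt × Pt) : ℕ → Set Pt
  | 0 => Set.range init
  | t + 1 => step (grp init c t) (c t)

/-- Extend a `Fin T`-indexed sequence of candidate pairs to an `ℕ`-indexed one. -/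
def extSeq {T : ℕ} (c : Fin T → Pt × Pt) : ℕ → Pt × Pt :=
  fun n => if h : n < T then c ⟨n, h⟩ else 0

/-- The law of the randomness driving the first `T` rounds of the process: `k` i.i.d.
initial members with law `μ`, and `T` i.i.d. candidate pairs, each pair being two i.i.d.
points with law `μ`. -/
def procMeasure (μ : Measure Pt) (k T : ℕ) :
    Measure ((Fin k → Pt) × (Fin T → Pt × Pt)) :=
  (Measure.pi fun _ => μ).prod (Measure.pi fun _ => μ.prod μ)


/-- The unit square `[0,1]²` in the plane. -/
def unitSquare : Set Pt := {x : Pt | ∀ i, x i ∈ Set.Icc (0 : ℝ) 1}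

/-- A square box in the plane. -/
def bx (a b : ℝ) : Set Pt := {x : Pt | ∀ i, x i ∈ Set.Icc a b}

lemma bx_eq (a b : ℝ) : bx a b = (MeasurableEquiv.toLp 2 (Fin 2 → ℝ)).symm ⁻¹'
    (Set.pi Set.univ fun _ => Set.Icc a b) := by
  ext x
  exact ⟨fun h i _ => h i, fun h i => h i (Set.mem_univ i)⟩

lemma meas_bx (a b : ℝ) : MeasurableSet (bx a b) := by
  rw [bx_eq]
  exact (MeasurableEquiv.measurable _) (MeasurableSet.univ_pi fun _ => measurableSet_Icc)

lemma vol_bx (a b : ℝ) : volume (bx a b) = ENNReal.ofReal (b - a) ^ 2 := by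
  rw [bx_eq, (EuclideanSpace.volume_preserving_symm_measurableEquiv_toLp (Fin 2)).measure_preimage
    (MeasurableSet.univ_pi fun _ => measurableSet_Icc).nullMeasurableSet]
  rw [volume_pi_pi]; simp

lemma unitSquare_eq : unitSquare = bx 0 1 := rfl

lemma mu_bx {a b : ℝ} (ha : 0 ≤ a) (hb : b ≤ 1) :
    (volume.restrict unitSquare) (bx a b) = ENNReal.ofReal (b - a) ^ 2 := by
  rw [Measure.restrict_apply (meas_bx a b), Set.inter_eq_left.2, vol_bx]
  intro x hx i
  exact ⟨ha.trans (hx i).1, (hx i).2.trans hb⟩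

instance : IsProbabilityMeasure (volume.restrict unitSquare) := ⟨by
  rw [Measure.restrict_apply_univ, unitSquare_eq, vol_bx]; simp⟩

lemma dist_iff (v p q : Pt) : dist v p ≤ dist v q ↔
    (v 0 - p 0)^2 + (v 1 - p 1)^2 ≤ (v 0 - q 0)^2 + (v 1 - q 1)^2 := by
  rw [EuclideanSpace.dist_eq, EuclideanSpace.dist_eq, Real.sqrt_le_sqrt_iff (by positivity)]
  simp [Fin.sum_univ_two, Real.dist_eq, sq_abs]

/-- pairs in the square not both in the corner box. -/
def okSet (r : ℝ) : Set (Pt × Pt) := (bx 0 1 ×ˢ bx 0 1) \ (bx 0 r ×ˢ bx 0 r)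

/-- pairs leading to acceptance of the first candidate. -/
def goodSet (r : ℝ) : Set (Pt × Pt) := bx (4/100*r) (5/100*r) ×ˢ bx 0 (1/100*r)

lemma accepts_good {r : ℝ} (hr : 0 < r) {G : Set Pt}
    (hG : ∀ v ∈ G, r / 10 < v 0 + v 1) (hG0 : G ⊆ bx 0 1)
    {c : Pt × Pt} (hc : c ∈ goodSet r) : Accepts G c.1 c.2 ∧ c.1 ∉ G := by
  obtain ⟨h1, h2⟩ := hc
  have a0 := h1 0
  have a1 := h1 1
  have b0 := h2 0
  have b1 := h2 1
  simp only [Set.mem_Icc] at a0 a1 b0 b1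
  constructor
  · intro v hv
    rw [dist_iff]
    have hs := hG v hv
    have v0 := (hG0 hv 0).1
    have v1 := (hG0 hv 1).1
    have k0 : 3/100*r * v 0 ≤ (c.1 0 - c.2 0) * v 0 :=
      mul_le_mul_of_nonneg_right (by linarith) v0
    have k1 : 3/100*r * v 1 ≤ (c.1 1 - c.2 1) * v 1 :=
      mul_le_mul_of_nonneg_right (by linarith) v1
    have k2 : r * (r/10) ≤ r * (v 0 + v 1) := mul_le_mul_of_nonneg_left hs.le hr.le
    have k3 : (c.1 0)^2 ≤ (5/100*r)^2 := pow_le_pow_left₀ (by linarith) a0.2 2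
    have k4 : (c.1 1)^2 ≤ (5/100*r)^2 := pow_le_pow_left₀ (by linarith) a1.2 2
    nlinarith [sq_nonneg (c.2 0), sq_nonneg (c.2 1)]
  · intro hv
    have := hG _ hv
    linarith [a0.2, a1.2]

lemma avoid_aux {r : ℝ} {u p q : Pt} (hu : u ∈ bx (6/10) 1)
    (hp : p ∈ bx 0 1) (hq : q ∈ bx 0 1) (hn : ¬ (p ∈ bx 0 r ∧ q ∈ bx 0 r))
    (hd : dist u p ≤ dist u q) : r / 10 < p 0 + p 1 := by
  by_contra hcon
  rw [not_lt] at hcon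
  rw [dist_iff] at hd
  have u0 := hu 0
  have u1 := hu 1
  have p0 := hp 0
  have p1 := hp 1
  have q0 := hq 0
  have q1 := hq 1
  simp only [Set.mem_Icc] at u0 u1 p0 p1 q0 q1
  have h1 : 0 ≤ q 0 * (2 * u 0 - q 0 - 2/10) := mul_nonneg q0.1 (by linarith)
  have h2 : 0 ≤ q 1 * (2 * u 1 - q 1 - 2/10) := mul_nonneg q1.1 (by linarith)
  have h3 : 0 ≤ p 0 * (1 - u 0) := mul_nonneg p0.1 (by linarith)
  have h4 : 0 ≤ p 1 * (1 - u 1) := mul_nonneg p1.1 (by linarith)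
  have h5 : q 0 + q 1 ≤ r := by nlinarith [sq_nonneg (p 0), sq_nonneg (p 1)]
  apply hn
  constructor
  · intro i; fin_cases i <;> constructor <;> simp <;> linarith
  · intro i; fin_cases i <;> constructor <;> simp <;> linarith

lemma grp_inv {k : ℕ} (hk : 1 ≤ k) {r : ℝ} (hr1 : r ≤ 1) {init : Fin k → Pt} {c : ℕ → Pt × Pt}
    (hi : ∀ j, init j ∈ bx (6/10) 1) (n : ℕ) (hc : ∀ i < n, c i ∈ okSet r) :
    (∀ v ∈ grp init c n, r / 10 < v 0 + v 1) ∧ grp init c n ⊆ bx 0 1 ∧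
      init ⟨0, hk⟩ ∈ grp init c n := by
  induction n with
  | zero =>
    refine ⟨?_, ?_, Set.mem_range_self _⟩
    · rintro _ ⟨j, rfl⟩
      linarith [(hi j 0).1, (hi j 1).1]
    · rintro _ ⟨j, rfl⟩ i
      exact ⟨by linarith [(hi j i).1], (hi j i).2⟩
  | succ n ih =>
    obtain ⟨h1, h2, h3⟩ := ih fun i hi => hc i (by omega)
    obtain ⟨⟨hp, hq⟩, hn⟩ := hc n (by omega)
    have hn' : ¬ ((c n).1 ∈ bx 0 r ∧ (c n).2 ∈ bx 0 r) := hn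
    simp only [grp, step]
    split_ifs with ha hb
    · refine ⟨?_, Set.insert_subset hp h2, Set.mem_insert_of_mem _ h3⟩
      rintro v (rfl | hv)
      · exact avoid_aux (hi _) hp hq hn' (ha _ h3)
      · exact h1 v hv
    · refine ⟨?_, Set.insert_subset hq h2, Set.mem_insert_of_mem _ h3⟩
      rintro v (rfl | hv)
      · exact avoid_aux (hi _) hq hp (fun h => hn' h.symm) (hb _ h3)
      · exact h1 v hv
    · exact ⟨h1, h2, h3⟩

lemma step_finite {G : Set Pt} (hG : G.Finite) (c : Pt × Pt) : (step G c).Finite := by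
  unfold step; split_ifs
  · exact hG.insert _
  · exact hG.insert _
  · exact hG

lemma subset_step (G : Set Pt) (c : Pt × Pt) : G ⊆ step G c := by
  unfold step; split_ifs
  · exact Set.subset_insert _ _
  · exact Set.subset_insert _ _
  · exact subset_rfl

lemma grp_finite {k : ℕ} (init : Fin k → Pt) (c : ℕ → Pt × Pt) (n : ℕ) :
    (grp init c n).Finite := by
  induction n with
  | zero => exact Set.finite_range _
  | succ n ih => exact step_finite ih _

/-- The side length of the corner box at time `t`. -/
def rad (t : ℕ) : ℝ := Real.sqrt (Real.sqrt (1 / (2 * ((t : ℝ) + 1))))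

lemma rad_pow (t : ℕ) : rad t ^ 4 = 1 / (2 * ((t : ℝ) + 1)) := by
  have : rad t ^ 4 = (rad t ^ 2) ^ 2 := by ring
  rw [this, rad, Real.sq_sqrt (by positivity), Real.sq_sqrt (by positivity)]

lemma rad_pos (t : ℕ) : 0 < rad t := by unfold rad; positivity

lemma rad_le (t : ℕ) : rad t ≤ 1 := by
  unfold rad
  rw [Real.sqrt_le_one, Real.sqrt_le_one, div_le_one (by positivity)]
  have : (0:ℝ) ≤ t := by positivity
  linarith

/-- The requirement for round `i` in the event of acceptance in round `t`. -/
def reqSet (t i : ℕ) : Set (Pt × Pt) :=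
  if i < t then okSet (rad t) else if i = t then goodSet (rad t) else Set.univ

/-- The acceptance event at round `t`. -/
def evSet (k T t : ℕ) : Set ((Fin k → Pt) × (Fin T → Pt × Pt)) :=
  (Set.pi Set.univ fun _ => bx (6/10) 1) ×ˢ (Set.pi Set.univ fun i : Fin T => reqSet t i)

lemma meas_ok (r : ℝ) : MeasurableSet (okSet r) :=
  ((meas_bx _ _).prod (meas_bx _ _)).diff ((meas_bx _ _).prod (meas_bx _ _))

lemma meas_req (t i : ℕ) : MeasurableSet (reqSet t i) := by
  unfold reqSet; split_ifs
  · exact meas_ok _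
  · exact (meas_bx _ _).prod (meas_bx _ _)
  · exact MeasurableSet.univ

lemma meas_ev (k T t : ℕ) : MeasurableSet (evSet k T t) :=
  (MeasurableSet.univ_pi fun _ => meas_bx _ _).prod (MeasurableSet.univ_pi fun _ => meas_req _ _)

lemma ncard_step {k T t : ℕ} (hk : 1 ≤ k) (ht : t < T)
    {ω : (Fin k → Pt) × (Fin T → Pt × Pt)} (h : ω ∈ evSet k T t) :
    (grp ω.1 (extSeq ω.2) t).ncard + 1 ≤ (grp ω.1 (extSeq ω.2) (t+1)).ncard := by
  obtain ⟨h1, h2⟩ := h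
  have hseq : ∀ i < T, extSeq ω.2 i ∈ reqSet t i := by
    intro i hi
    have := h2 ⟨i, hi⟩ (Set.mem_univ _)
    simpa [extSeq, hi] using this
  obtain ⟨g1, g2, -⟩ := grp_inv hk (rad_le t) (fun j => h1 j (Set.mem_univ _)) t
    (c := extSeq ω.2) (fun i hi => by
      have := hseq i (by omega)
      simpa [reqSet, hi] using this)
  have hg : extSeq ω.2 t ∈ goodSet (rad t) := by
    have := hseq t ht
    simpa [reqSet] using this
  obtain ⟨ha, hn⟩ := accepts_good (rad_pos t) g1 g2 hg
  rw [grp, step, if_pos ha, Set.ncard_insert_of_notMem hn (grp_finite _ _ _)]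

lemma ncard_sum {k T : ℕ} (hk : 1 ≤ k) (ω : (Fin k → Pt) × (Fin T → Pt × Pt)) (n : ℕ)
    (hn : n ≤ T) :
    ∑ t ∈ Finset.range n, (evSet k T t).indicator (fun _ => (1:ℝ≥0∞)) ω ≤
      ((grp ω.1 (extSeq ω.2) n).ncard : ℝ≥0∞) := by
  induction n with
  | zero => simp
  | succ n ih =>
    rw [Finset.sum_range_succ]
    have ih' := ih (by omega)
    by_cases h : ω ∈ evSet k T n
    · rw [Set.indicator_of_mem h]
      refine (add_le_add_left ih' 1).trans ?_
      exact_mod_cast ncard_step hk (by omega) h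
    · rw [Set.indicator_of_notMem h, add_zero]
      refine ih'.trans ?_
      exact_mod_cast Set.ncard_le_ncard (subset_step _ _) (grp_finite _ _ (n+1))

lemma mu_good (t : ℕ) : ((volume.restrict unitSquare).prod (volume.restrict unitSquare))
    (goodSet (rad t)) = ENNReal.ofReal (1 / 10^8 * rad t ^ 4) := by
  have h0 := rad_pos t
  have h1 := rad_le t
  rw [goodSet, Measure.prod_prod, mu_bx (by positivity) (by linarith), mu_bx le_rfl (by linarith),
    ← ENNReal.ofReal_pow (by linarith), ← ENNReal.ofReal_pow (by linarith),
    ← ENNReal.ofReal_mul (by positivity)]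
  congr 1; ring

lemma mu_ok (t : ℕ) : ((volume.restrict unitSquare).prod (volume.restrict unitSquare))
    (okSet (rad t)) = ENNReal.ofReal (1 - rad t ^ 4) := by
  have h0 := rad_pos t
  have h1 := rad_le t
  rw [okSet, measure_sdiff (Set.prod_mono _ _)
    ((meas_bx _ _).prod (meas_bx _ _)).nullMeasurableSet (measure_ne_top _ _),
    Measure.prod_prod, Measure.prod_prod, mu_bx le_rfl le_rfl, mu_bx le_rfl h1,
    ENNReal.ofReal_sub 1 (by positivity : 0 ≤ rad t ^ 4), sub_zero, sub_zero,
    ← ENNReal.ofReal_pow h0.le, ← ENNReal.ofReal_mul (by positivity), ENNReal.ofReal_one,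
    one_pow, one_mul, ← pow_add]
  all_goals exact fun x hx i => ⟨(hx i).1, (hx i).2.trans h1⟩

lemma ev_measure (k T t : ℕ) (ht : t < T) :
    ENNReal.ofReal ((16/100)^k / (4 * 10^8) * (1 / ((t:ℝ) + 1))) ≤
      procMeasure (volume.restrict unitSquare) k T (evSet k T t) := by
  have h0 := rad_pos t
  have h1 := rad_le t
  have h4 : rad t ^ 4 ≤ 1 := pow_le_one₀ h0.le h1
  rw [procMeasure, evSet, Measure.prod_prod, Measure.pi_pi, Measure.pi_pi,
    mu_bx (by norm_num) le_rfl, Finset.prod_const, Finset.card_univ, Fintype.card_fin,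
    Fin.prod_univ_eq_prod_range (fun i => ((volume.restrict unitSquare).prod
      (volume.restrict unitSquare)) (reqSet t i)) T]
  have hsub : Finset.range (t+1) ⊆ Finset.range T := Finset.range_subset_range.2 ht
  rw [← Finset.prod_subset hsub (fun i _ hi => by
    have : t + 1 ≤ i := by simpa using hi
    rw [reqSet, if_neg (by omega), if_neg (by omega), measure_univ])]
  rw [Finset.prod_range_succ, Finset.prod_congr rfl (g := fun _ => ENNReal.ofReal (1 - rad t ^ 4))
    (fun i hi => by rw [reqSet, if_pos (Finset.mem_range.1 hi), mu_ok])]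
  rw [Finset.prod_const, Finset.card_range]
  have : reqSet t t = goodSet (rad t) := by simp [reqSet]
  rw [this, mu_good, ← ENNReal.ofReal_pow (by norm_num), ← ENNReal.ofReal_pow (by norm_num),
    ← ENNReal.ofReal_pow (by linarith), ← ENNReal.ofReal_mul (pow_nonneg (by linarith) _),
    ← ENNReal.ofReal_mul (by positivity)]
  apply ENNReal.ofReal_le_ofReal
  have hb : 1/2 ≤ (1 - rad t ^ 4) ^ t := by
    have := one_add_mul_le_pow (a := - rad t ^ 4) (by linarith) t
    rw [← sub_eq_add_neg] at this
    refine le_trans ?_ this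
    rw [rad_pow]
    have : (t:ℝ) * (1 / (2 * ((t:ℝ)+1))) ≤ 1/2 := by
      rw [mul_one_div, div_le_div_iff₀ (by positivity) (by positivity)]; linarith
    linarith
  have e : ((1 - 6/10 : ℝ)^2)^k = (16/100)^k := by norm_num
  rw [e]
  calc (16/100:ℝ)^k / (4 * 10^8) * (1 / ((t:ℝ) + 1))
      = (16/100)^k * (1/2 * (1 / 10^8 * rad t ^ 4)) := by
        rw [rad_pow]; field_simp; norm_num
    _ ≤ _ := by gcongr

/-- For the consensus-voting group process on the unit square
`ℍ = [0,1]²` (with `k ≥ 1` uniform initial members and two i.i.d. uniform candidates per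
round), there is a constant `c > 0` such that for every `T ≥ 2` the expected group size
after `T` rounds satisfies `E[|G^T|] ≥ c · ln T`. -/
theorem expected_group_size_square_lower (k : ℕ) (hk : 1 ≤ k) :
    ∃ c : ℝ, 0 < c ∧ ∀ T : ℕ, 2 ≤ T →
      ENNReal.ofReal (c * Real.log T) ≤
        ∫⁻ ω, ((grp ω.1 (extSeq ω.2) T).ncard : ℝ≥0∞)
          ∂(procMeasure (volume.restrict unitSquare) k T) := by
  refine ⟨(16/100)^k / (4 * 10^8), by positivity, fun T hT => ?_⟩
  set C : ℝ := (16/100)^k / (4 * 10^8) with hC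
  have hC0 : 0 < C := by positivity
  calc ENNReal.ofReal (C * Real.log T)
      ≤ ENNReal.ofReal (∑ t ∈ Finset.range T, C * (1 / ((t:ℝ) + 1))) := by
        apply ENNReal.ofReal_le_ofReal
        rw [← Finset.mul_sum]
        gcongr
        have h1 := log_add_one_le_harmonic T
        have h2 : Real.log T ≤ Real.log ((T + 1 : ℕ) : ℝ) := by
          apply Real.log_le_log
          · exact_mod_cast (by omega : 0 < T)
          · push_cast; linarith
        refine h2.trans (h1.trans ?_)
        simp [harmonic]
    _ = ∑ t ∈ Finset.range T, ENNReal.ofReal (C * (1 / ((t:ℝ) + 1))) :=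
        ENNReal.ofReal_sum_of_nonneg fun t _ => by positivity
    _ ≤ ∑ t ∈ Finset.range T, procMeasure (volume.restrict unitSquare) k T (evSet k T t) :=
        Finset.sum_le_sum fun t ht => ev_measure k T t (Finset.mem_range.1 ht)
    _ = ∫⁻ ω, ∑ t ∈ Finset.range T, (evSet k T t).indicator (fun _ => (1:ℝ≥0∞)) ω
          ∂(procMeasure (volume.restrict unitSquare) k T) := by
        rw [lintegral_finsetSum _ fun t _ => measurable_const.indicator (meas_ev k T t)]
        refine Finset.sum_congr rfl fun t _ => ?_
        rw [lintegral_indicator (meas_ev k T t)]; simp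
    _ ≤ _ := lintegral_mono fun ω => ncard_sum hk ω T le_rfl

end
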